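/- There is a universal constant C > 0 such that for every SNN instance with k ≥ 3 queries, there exists an assignment p_1, …, p_k with all p_i ∈ P̂ whose SNN cost is at most C · (log k / log log k) · Cost(Q, G, P). In other words, the pruning gap of the Independent Nearest Neighbors algorithm is α = O(log k / log log k). -/

import Mathlib

open Finset

/-- The symmetric pairwise-distance function induced on unordered pairs by an
assignment `p : V → X`. -/
noncomputable def pairDist {V X : Type*} [MetricSpace X] (p : V → X) : Sym2 V → ℝ :=
  Sym2.lift ⟨fun i j => dist (p i) (p j), fun i j => dist_comm (p i) (p j)⟩

noncomputable def snnD (μ ν u : ℝ) : ℝ := (⌈ν - u⌉ : ℝ) - (⌈μ - u⌉ : ℝ)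

lemma snnD_nonneg {μ ν : ℝ} (h : μ ≤ ν) (u : ℝ) : 0 ≤ snnD μ ν u := by
  unfold snnD
  have : ⌈μ - u⌉ ≤ ⌈ν - u⌉ := Int.ceil_mono (by linarith)
  have : (⌈μ - u⌉ : ℝ) ≤ ⌈ν - u⌉ := by exact_mod_cast this
  linarith

lemma snn_ceil_int (μ : ℝ) :
    IntervalIntegrable (fun u : ℝ => (⌈μ - u⌉ : ℝ)) MeasureTheory.volume 0 1 := by
  apply Antitone.intervalIntegrable
  intro a b hab
  have : ⌈μ - b⌉ ≤ ⌈μ - a⌉ := Int.ceil_mono (by linarith)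
  simpa using this

lemma snnD_int (μ ν : ℝ) : IntervalIntegrable (snnD μ ν) MeasureTheory.volume 0 1 :=
  (snn_ceil_int ν).sub (snn_ceil_int μ)

lemma snn_ceil_integral (μ : ℝ) :
    ∫ u in (0:ℝ)..1, ((⌈μ - u⌉ : ℝ) - (μ - u)) = ∫ t in (0:ℝ)..1, ((⌈t⌉ : ℝ) - t) := by
  have hp : Function.Periodic (fun t : ℝ => (⌈t⌉ : ℝ) - t) 1 := by
    intro t
    simp only [Int.ceil_add_one]
    push_cast
    ring
  rw [intervalIntegral.integral_comp_sub_left (fun t : ℝ => (⌈t⌉ : ℝ) - t) μ]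
  have := hp.intervalIntegral_add_eq (μ - 1) 0
  simpa using this

lemma snnD_integral (μ ν : ℝ) : ∫ u in (0:ℝ)..1, snnD μ ν u = ν - μ := by
  have h1 := snn_ceil_integral μ
  have h2 := snn_ceil_integral ν
  have hl : ∀ a : ℝ, IntervalIntegrable (fun u : ℝ => a - u) MeasureTheory.volume 0 1 :=
    fun a => (continuous_const.sub continuous_id).intervalIntegrable _ _
  have hc : ∀ a : ℝ, ∫ u in (0:ℝ)..1, (a - u) = a - 1/2 := by
    intro a
    rw [intervalIntegral.integral_sub (by simp) (by simp)]
    simp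
  rw [intervalIntegral.integral_sub (snn_ceil_int _) (hl _), hc] at h1 h2
  unfold snnD
  rw [intervalIntegral.integral_sub (snn_ceil_int _) (snn_ceil_int _)]
  linarith

noncomputable def snnRad (l A u : ℝ) : ℝ :=
  if A = 0 then 0 else Real.exp (l * ((⌈Real.log A / l - u⌉ : ℝ) + u))

lemma snnRad_ge {l A : ℝ} (hl : 0 < l) (hA : 0 ≤ A) (u : ℝ) : A ≤ snnRad l A u := by
  unfold snnRad
  split_ifs with h
  · exact h.le
  · have hA' : 0 < A := lt_of_le_of_ne hA (Ne.symm h)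
    rw [← Real.log_le_iff_le_exp hA', ← div_le_iff₀' hl]
    have := Int.le_ceil (Real.log A / l - u)
    linarith

lemma snnRad_le {l A : ℝ} (hl : 0 < l) (hA : 0 ≤ A) (u : ℝ) :
    snnRad l A u ≤ Real.exp l * A := by
  unfold snnRad
  split_ifs with h
  · simp [h]
  · have hA' : 0 < A := lt_of_le_of_ne hA (Ne.symm h)
    have h1 : Real.exp l * A = Real.exp (l * (1 + Real.log A / l)) := by
      rw [mul_add, mul_div_cancel₀ _ hl.ne', mul_one, Real.exp_add, Real.exp_log hA']
    rw [h1]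
    apply Real.exp_le_exp.2
    apply mul_le_mul_of_nonneg_left _ hl.le
    have := Int.ceil_lt_add_one (Real.log A / l - u)
    linarith

lemma snnRad_ne {l A B : ℝ} (hl : 0 < l) (hA : 0 < A) (hAB : A ≤ B) (u : ℝ)
    (h : snnRad l A u ≠ snnRad l B u) :
    1 ≤ snnD (Real.log A / l) (Real.log B / l) u := by
  have hB : 0 < B := hA.trans_le hAB
  unfold snnRad at h
  rw [if_neg hA.ne', if_neg hB.ne'] at h
  have hne : ⌈Real.log A / l - u⌉ ≠ ⌈Real.log B / l - u⌉ := by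
    intro he
    rw [he] at h
    exact h rfl
  have hle : ⌈Real.log A / l - u⌉ ≤ ⌈Real.log B / l - u⌉ := by
    apply Int.ceil_mono
    have := Real.log_le_log hA hAB
    have := div_le_div_of_nonneg_right this hl.le
    linarith
  have : ⌈Real.log A / l - u⌉ + 1 ≤ ⌈Real.log B / l - u⌉ := by omega
  have : (⌈Real.log A / l - u⌉ : ℝ) + 1 ≤ ⌈Real.log B / l - u⌉ := by exact_mod_cast this
  unfold snnD
  linarith

lemma snnRad_cut {l A m d : ℝ} (hl : 0 < l) (hA : 0 < A) (hm : 0 < m) (u : ℝ)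
    (h1 : m ≤ snnRad l A u) (h2 : snnRad l A u < m + d) :
    1 ≤ snnD (Real.log m / l) (Real.log (m + d) / l) u := by
  unfold snnRad at h1 h2
  rw [if_neg hA.ne'] at h1 h2
  set n := ⌈Real.log A / l - u⌉ with hn
  rw [← Real.log_le_iff_le_exp hm, ← div_le_iff₀' hl] at h1
  have hmd : 0 < m + d := (Real.exp_pos _).trans h2
  rw [← Real.lt_log_iff_exp_lt hmd, ← lt_div_iff₀' hl] at h2
  have a1 : ⌈Real.log m / l - u⌉ ≤ n := Int.ceil_le.2 (by linarith)
  have a2 : n < ⌈Real.log (m + d) / l - u⌉ := Int.lt_ceil.2 (by linarith)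
  have : ⌈Real.log m / l - u⌉ + 1 ≤ ⌈Real.log (m + d) / l - u⌉ := by omega
  have : (⌈Real.log m / l - u⌉ : ℝ) + 1 ≤ ⌈Real.log (m + d) / l - u⌉ := by exact_mod_cast this
  unfold snnD
  linarith

lemma snn_log_diff {l m d : ℝ} (hl : 0 < l) (hm : 0 < m) (hd : 0 ≤ d) :
    m * (Real.log (m + d) / l - Real.log m / l) ≤ d / l := by
  rw [← sub_div, ← Real.log_div (by positivity) hm.ne']
  have : Real.log ((m + d) / m) ≤ (m + d) / m - 1 := Real.log_le_sub_one_of_pos (by positivity)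
  rw [mul_div_assoc']
  apply div_le_div_of_nonneg_right _ hl.le
  calc m * Real.log ((m + d) / m) ≤ m * ((m + d) / m - 1) :=
        mul_le_mul_of_nonneg_left this hm.le
    _ = d := by field_simp; ring

/-- harmonic rank bound -/
lemma snn_rank {ι : Type*} [DecidableEq ι] (m : ι → ℝ) (s : Finset ι) :
    ∑ i ∈ s, (1 : ℝ) / ((s.filter (fun j => m j ≤ m i)).card : ℝ) ≤ (harmonic s.card : ℝ) := by
  induction s using Finset.induction_on_max_value m with
  | empty => simp
  | insert a s ha hmax ih =>
    rw [Finset.sum_insert ha, Finset.card_insert_of_notMem ha, harmonic_succ]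
    have h1 : (insert a s).filter (fun j => m j ≤ m a) = insert a s := by
      apply Finset.filter_true_of_mem
      intro x hx
      rcases Finset.mem_insert.1 hx with rfl | hx
      · exact le_rfl
      · exact hmax x hx
    rw [h1, Finset.card_insert_of_notMem ha]
    have h2 : ∑ i ∈ s, (1 : ℝ) / (((insert a s).filter (fun j => m j ≤ m i)).card : ℝ)
        ≤ ∑ i ∈ s, (1 : ℝ) / ((s.filter (fun j => m j ≤ m i)).card : ℝ) := by
      apply Finset.sum_le_sum
      intro i hi
      apply one_div_le_one_div_of_le
      · have : 0 < (s.filter (fun j => m j ≤ m i)).card :=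
          Finset.card_pos.2 ⟨i, by simp [hi]⟩
        exact_mod_cast this
      · have := Finset.card_le_card
          (Finset.filter_subset_filter (fun j => m j ≤ m i) (Finset.subset_insert a s))
        exact_mod_cast this
    push_cast
    rw [one_div]
    linarith

/-- random permutation: probability of being first -/
lemma snn_perm {k : ℕ} (S : Finset (Fin k)) (i : Fin k) (hi : i ∈ S) :
    ((Finset.univ.filter (fun σ : Equiv.Perm (Fin k) => ∀ j ∈ S, σ i ≤ σ j)).card : ℝ)
      ≤ (Nat.factorial k : ℝ) * (1 / (S.card : ℝ)) := by
  classical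
  set E : Fin k → Finset (Equiv.Perm (Fin k)) :=
    fun i => Finset.univ.filter (fun σ : Equiv.Perm (Fin k) => ∀ j ∈ S, σ i ≤ σ j) with hE
  have hswap : ∀ a ∈ S, (E i).card ≤ (E a).card := by
    intro a ha
    apply Finset.card_le_card_of_injOn (fun σ => (Equiv.swap i a).trans σ)
    · intro σ hσ
      simp only [hE, Finset.coe_filter, Finset.mem_univ, true_and, Set.mem_ofPred_eq] at hσ ⊢
      intro j hj
      simp only [Equiv.trans_apply, Equiv.swap_apply_right]
      apply hσ
      rw [Equiv.swap_apply_def]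
      split_ifs <;> assumption
    · intro σ _ τ _ h
      ext x
      have := congrArg (fun e => e (Equiv.swap i a x)) h
      simpa using congrArg Fin.val this
  have hdisj : (S : Set (Fin k)).PairwiseDisjoint E := by
    intro a ha b hb hab
    rw [Function.onFun, Finset.disjoint_left]
    intro σ h1 h2
    simp only [hE, Finset.mem_filter, Finset.mem_univ, true_and] at h1 h2
    exact hab (σ.injective (le_antisymm (h1 b hb) (h2 a ha)))
  have hsum : S.card * (E i).card ≤ Nat.factorial k := by
    calc S.card * (E i).card = ∑ a ∈ S, (E i).card := by simp
      _ ≤ ∑ a ∈ S, (E a).card := Finset.sum_le_sum hswap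
      _ = (S.biUnion E).card := (Finset.card_biUnion hdisj).symm
      _ ≤ (Finset.univ : Finset (Equiv.Perm (Fin k))).card := Finset.card_le_univ _
      _ = Nat.factorial k := by simp [Fintype.card_perm]
  have hS : 0 < (S.card : ℝ) := by exact_mod_cast Finset.card_pos.2 ⟨i, hi⟩
  have hsum' : (S.card : ℝ) * ((E i).card : ℝ) ≤ Nat.factorial k := by exact_mod_cast hsum
  rw [mul_one_div, le_div_iff₀ hS]
  linarith

lemma snn_edge {X : Type*} [MetricSpace X] {k : ℕ} (l : ℝ) (hl : 1 ≤ l) (T : Fin k → X)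
    (A : X → ℝ) (hA0 : ∀ x, 0 ≤ A x) (hAle : ∀ x i, A x ≤ dist x (T i))
    (hLip : ∀ x y, A x ≤ A y + dist x y)
    (I : X → ℝ → Equiv.Perm (Fin k) → Fin k)
    (hI1 : ∀ x u σ, dist x (T (I x u σ)) ≤ snnRad l (A x) u)
    (hI2 : ∀ (x : X) (u : ℝ) (σ : Equiv.Perm (Fin k)) (j : Fin k), dist x (T j) ≤ snnRad l (A x) u → σ (I x u σ) ≤ σ j) (x y : X) :
    ∃ g : ℝ → ℝ, IntervalIntegrable g MeasureTheory.volume 0 1 ∧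
      ∫ u in (0:ℝ)..1, g u ≤ (6 * Real.exp l + 9 / 2 * (1 + Real.log k) / l) * dist x y ∧
      ∀ u, ∑ σ : Equiv.Perm (Fin k), dist (T (I x u σ)) (T (I y u σ)) ≤
        (Nat.factorial k : ℝ) * g u := by
  classical
  wlog hxy : A x ≤ A y generalizing x y
  · obtain ⟨g, h1, h2, h3⟩ := this y x (le_of_not_ge hxy)
    refine ⟨g, h1, by rwa [dist_comm x y], fun u => ?_⟩
    simpa [dist_comm] using h3 u
  have hl0 : 0 < l := by linarith
  set R := Real.exp l with hR
  have hR1 : 1 ≤ R := Real.one_le_exp hl0.le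
  set d := dist x y with hd
  have hd0 : 0 ≤ d := dist_nonneg
  have hlogk : 0 ≤ Real.log k := Real.log_natCast_nonneg k
  have htri : ∀ u σ, dist (T (I x u σ)) (T (I y u σ)) ≤
      snnRad l (A x) u + d + snnRad l (A y) u := by
    intro u σ
    have h1 := dist_triangle4 (T (I x u σ)) x y (T (I y u σ))
    have h2 := hI1 x u σ
    have h3 := hI1 y u σ
    rw [dist_comm] at h2
    linarith
  have hLyx : A y ≤ A x + d := by have := hLip y x; rwa [dist_comm y x] at this
  have hcardP : (Finset.univ : Finset (Equiv.Perm (Fin k))).card = Nat.factorial k := by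
    simp [Fintype.card_perm]
  have hKd : 0 ≤ 9 / 2 * (1 + Real.log k) / l * d := by positivity
  by_cases hc : A x ≤ 2 * d
  · refine ⟨fun _ => 6 * R * d, by simp, ?_, ?_⟩
    · simp only [intervalIntegral.integral_const, sub_zero, one_smul]
      linarith
    · intro u
      rw [← hcardP, ← nsmul_eq_mul]
      apply Finset.sum_le_card_nsmul
      intro σ _
      have h1 := htri u σ
      have h2 := snnRad_le hl0 (hA0 x) u
      have h3 := snnRad_le hl0 (hA0 y) u
      nlinarith [hA0 x, hA0 y]
  push Not at hc
  have hAx : 0 < A x := by linarith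
  have hAy : 0 < A y := by linarith
  set m : Fin k → ℝ := fun i => min (dist x (T i)) (dist y (T i)) with hm
  have hmA : ∀ i, A x ≤ m i := fun i => le_min (hAle x i) (hxy.trans (hAle y i))
  have hm0 : ∀ i, 0 < m i := fun i => hAx.trans_le (hmA i)
  set S : Fin k → Finset (Fin k) := fun i => Finset.univ.filter (fun j => m j ≤ m i) with hS
  set Dx : ℝ → ℝ := snnD (Real.log (A x) / l) (Real.log (A y) / l) with hDx
  set Di : Fin k → ℝ → ℝ := fun i => snnD (Real.log (m i) / l) (Real.log (m i + d) / l) with hDi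
  have hDx0 : ∀ u, 0 ≤ Dx u := fun u => snnD_nonneg
    (div_le_div_of_nonneg_right (Real.log_le_log hAx hxy) hl0.le) u
  have hDi0 : ∀ i u, 0 ≤ Di i u := fun i u => snnD_nonneg
    (div_le_div_of_nonneg_right (Real.log_le_log (hm0 i) (by linarith)) hl0.le) u
  -- pointwise bound
  have hpt : ∀ u σ, dist (T (I x u σ)) (T (I y u σ)) ≤ 3 * R * A x * Dx u +
      ∑ i, (9 / 2 * m i * Di i u) * (if ∀ j ∈ S i, σ i ≤ σ j then 1 else 0) := by
    intro u σ
    have hterm : ∀ i, 0 ≤ (9 / 2 * m i * Di i u) *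
        (if ∀ j ∈ S i, σ i ≤ σ j then (1 : ℝ) else 0) := by
      intro i
      have := hm0 i
      have := hDi0 i u
      split_ifs <;> positivity
    have hsum0 := Finset.sum_nonneg (fun i (_ : i ∈ Finset.univ) => hterm i)
    have hfirst : 0 ≤ 3 * R * A x * Dx u := by
      have := hDx0 u
      positivity
    have h1 := htri u σ
    by_cases hr : snnRad l (A x) u = snnRad l (A y) u
    · set r := snnRad l (A x) u with hrdef
      by_cases heq : I x u σ = I y u σ
      · rw [heq, dist_self]
        positivity
      have hrA : A x ≤ r := snnRad_ge hl0 hAx.le u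
      have hx1 := hI1 x u σ
      have hy1 := hI1 y u σ
      have hx2 := hI2 x u σ
      have hy2 := hI2 y u σ
      rw [← hr] at hy1 hy2
      have key : ∃ t, m t ≤ r ∧ r < m t + d ∧ ∀ j, m j ≤ r → σ t ≤ σ j := by
        have hT : ∀ i, dist y (T i) ≤ dist x (T i) + d := fun i => by
          have := dist_triangle y x (T i)
          rw [dist_comm y x] at this
          linarith
        have hT' : ∀ i, dist x (T i) ≤ dist y (T i) + d := fun i => by
          have := dist_triangle x y (T i)
          linarith
        rcases le_total (σ (I x u σ)) (σ (I y u σ)) with hs | hs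
        · refine ⟨I x u σ, (min_le_left _ _).trans hx1, ?_, ?_⟩
          · by_contra hcon
            apply heq
            apply σ.injective
            apply le_antisymm hs
            apply hy2
            refine le_trans ?_ (not_lt.1 hcon)
            rw [hm]
            simp only
            rw [← sub_le_iff_le_add]
            apply le_min
            · have := hT (I x u σ); linarith
            · linarith
          · intro j hj
            rcases min_le_iff.1 hj with hj | hj
            · exact hx2 j hj
            · exact hs.trans (hy2 j hj)
        · refine ⟨I y u σ, (min_le_right _ _).trans hy1, ?_, ?_⟩
          · by_contra hcon
            apply heq
            apply σ.injective
            refine le_antisymm ?_ hs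
            apply hx2
            refine le_trans ?_ (not_lt.1 hcon)
            rw [hm]
            simp only
            rw [← sub_le_iff_le_add]
            apply le_min
            · linarith
            · have := hT' (I y u σ); linarith
          · intro j hj
            rcases min_le_iff.1 hj with hj | hj
            · exact hs.trans (hx2 j hj)
            · exact hy2 j hj
      obtain ⟨t, ht1, ht2, ht3⟩ := key
      have hcut : 1 ≤ Di t u := snnRad_cut hl0 hAx (hm0 t) u ht1 ht2
      have hle := Finset.single_le_sum (fun i _ => hterm i) (Finset.mem_univ t)
      have hmin : ∀ j ∈ S t, σ t ≤ σ j := by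
        intro j hj
        simp only [hS, Finset.mem_filter, Finset.mem_univ, true_and] at hj
        exact ht3 j (hj.trans ht1)
      simp only [if_pos hmin, mul_one] at hle
      have hmt := hmA t
      have h5 : 9 / 2 * m t ≤ 9 / 2 * m t * Di t u :=
        le_mul_of_one_le_right (by have := hm0 t; positivity) hcut
      rw [← hr] at h1
      linarith
    · have h4 := snnRad_ne hl0 hAx hxy u hr
      have h2 := snnRad_le hl0 (hA0 x) u
      have h3 := snnRad_le hl0 (hA0 y) u
      have h5 : 3 * R * A x ≤ 3 * R * A x * Dx u := le_mul_of_one_le_right (by positivity) h4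
      have h6 : R * A y ≤ R * (A x + d) := mul_le_mul_of_nonneg_left hLyx (by positivity)
      have h7 : R * (2 * d) ≤ R * A x := mul_le_mul_of_nonneg_left hc.le (by positivity)
      have h8 : d ≤ R * d := le_mul_of_one_le_left hd0 hR1
      linarith
  have hDii : ∀ i, IntervalIntegrable (fun u => (9 / 2 * m i * Di i u) * (1 / ((S i).card : ℝ)))
      MeasureTheory.volume 0 1 := fun i => ((snnD_int _ _).const_mul _).mul_const _
  have hDxi : IntervalIntegrable (fun u => 3 * R * A x * Dx u) MeasureTheory.volume 0 1 :=
    (snnD_int _ _).const_mul _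
  have hsumi : IntervalIntegrable
      (fun u => ∑ i, (9 / 2 * m i * Di i u) * (1 / ((S i).card : ℝ)))
      MeasureTheory.volume 0 1 := by
    have h := IntervalIntegrable.sum Finset.univ (fun i _ => hDii i)
    have he : (fun u => ∑ i, (9 / 2 * m i * Di i u) * (1 / ((S i).card : ℝ))) =
        ∑ i, fun u => (9 / 2 * m i * Di i u) * (1 / ((S i).card : ℝ)) := by
      funext u
      rw [Finset.sum_apply]
    rw [he]
    exact h
  refine ⟨fun u => 3 * R * A x * Dx u +
      ∑ i, (9 / 2 * m i * Di i u) * (1 / ((S i).card : ℝ)), hDxi.add hsumi, ?_, ?_⟩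
  · rw [intervalIntegral.integral_add hDxi hsumi,
      intervalIntegral.integral_finsetSum (fun i _ => hDii i)]
    simp only [intervalIntegral.integral_const_mul, intervalIntegral.integral_mul_const, hDx, hDi,
      snnD_integral]
    have hA1 : A x * (Real.log (A y) / l - Real.log (A x) / l) ≤ d / l := by
      refine le_trans ?_ (snn_log_diff hl0 hAx hd0)
      apply mul_le_mul_of_nonneg_left _ hAx.le
      have := div_le_div_of_nonneg_right (Real.log_le_log hAy hLyx) hl0.le
      linarith
    have hdl : d / l ≤ d := div_le_self hd0 hl
    have h1 : 3 * R * A x * (Real.log (A y) / l - Real.log (A x) / l) ≤ 6 * R * d := by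
      have : 3 * R * (A x * (Real.log (A y) / l - Real.log (A x) / l)) ≤ 3 * R * d :=
        mul_le_mul_of_nonneg_left (hA1.trans hdl) (by positivity)
      have : 0 ≤ R * d := by positivity
      linarith
    have h2 : ∑ i, (9 / 2 * m i * (Real.log (m i + d) / l - Real.log (m i) / l)) *
        (1 / ((S i).card : ℝ)) ≤ 9 / 2 * (d / l) * (1 + Real.log k) := by
      calc _ ≤ ∑ i, (9 / 2 * (d / l)) * (1 / ((S i).card : ℝ)) := by
            apply Finset.sum_le_sum
            intro i _
            apply mul_le_mul_of_nonneg_right _ (by positivity)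
            have := snn_log_diff hl0 (hm0 i) hd0
            linarith
        _ = (9 / 2 * (d / l)) * ∑ i, (1 / ((S i).card : ℝ)) := by rw [Finset.mul_sum]
        _ ≤ _ := by
            apply mul_le_mul_of_nonneg_left _ (by positivity)
            have := snn_rank m Finset.univ
            have h' := harmonic_le_one_add_log k
            simp only [Finset.card_univ, Fintype.card_fin] at this
            exact this.trans h'
    have h3 : 9 / 2 * (1 + Real.log k) / l * d = 9 / 2 * (d / l) * (1 + Real.log k) := by
      ring
    rw [add_mul, h3]
    linarith
  · intro u
    calc _ ≤ ∑ σ : Equiv.Perm (Fin k), (3 * R * A x * Dx u +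
          ∑ i, (9 / 2 * m i * Di i u) * (if ∀ j ∈ S i, σ i ≤ σ j then 1 else 0)) :=
          Finset.sum_le_sum (fun σ _ => hpt u σ)
      _ = (Nat.factorial k : ℝ) * (3 * R * A x * Dx u) + ∑ i, (9 / 2 * m i * Di i u) *
          ((Finset.univ.filter
            (fun σ : Equiv.Perm (Fin k) => ∀ j ∈ S i, σ i ≤ σ j)).card : ℝ) := by
          rw [Finset.sum_add_distrib, Finset.sum_const, hcardP, nsmul_eq_mul, Finset.sum_comm]
          congr 1
          apply Finset.sum_congr rfl
          intro i _
          rw [← Finset.mul_sum, Finset.sum_boole]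
      _ ≤ (Nat.factorial k : ℝ) * (3 * R * A x * Dx u) + ∑ i, (9 / 2 * m i * Di i u) *
          ((Nat.factorial k : ℝ) * (1 / ((S i).card : ℝ))) := by
          gcongr with i _
          · have := hm0 i
            have := hDi0 i u
            positivity
          · exact snn_perm (S i) i (by simp [hS])
      _ = _ := by
          rw [mul_add, Finset.mul_sum]
          congr 1
          apply Finset.sum_congr rfl
          intro i _
          ring

/-- Zero-extension rounding with respect to the terminals `T`. -/
lemma snn_round {X : Type*} [MetricSpace X] {k : ℕ} (hk : 0 < k) (l : ℝ) (hl : 1 ≤ l)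
    (T : Fin k → X) (ps : Fin k → X) (E : Finset (Sym2 (Fin k))) :
    ∃ f : Fin k → Fin k, (∀ i, dist (ps i) (T (f i)) ≤ Real.exp l * dist (ps i) (T i)) ∧
      ∑ e ∈ E, pairDist (fun i => T (f i)) e ≤
        (6 * Real.exp l + 9 / 2 * (1 + Real.log k) / l) * ∑ e ∈ E, pairDist ps e := by
  classical
  have hl0 : 0 < l := by linarith
  have : Nonempty (Fin k) := ⟨⟨0, hk⟩⟩
  have hne : (Finset.univ : Finset (Fin k)).Nonempty := Finset.univ_nonempty
  have hmin : ∀ x : X, ∃ i, ∀ j, dist x (T i) ≤ dist x (T j) := by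
    intro x
    obtain ⟨i, _, hi⟩ := Finset.exists_min_image Finset.univ (fun i => dist x (T i)) hne
    exact ⟨i, fun j => hi j (Finset.mem_univ j)⟩
  choose N hN using hmin
  set A : X → ℝ := fun x => dist x (T (N x)) with hA
  have hA0 : ∀ x, 0 ≤ A x := fun x => dist_nonneg
  have hLip : ∀ x y, A x ≤ A y + dist x y := by
    intro x y
    have h1 := hN x (N y)
    have h2 := dist_triangle x y (T (N y))
    simp only [hA]
    linarith
  have hsel : ∀ (x : X) (u : ℝ) (σ : Equiv.Perm (Fin k)), ∃ i,
      dist x (T i) ≤ snnRad l (A x) u ∧ ∀ j, dist x (T j) ≤ snnRad l (A x) u → σ i ≤ σ j := by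
    intro x u σ
    obtain ⟨i, hi, hi'⟩ := Finset.exists_min_image
      (Finset.univ.filter (fun i => dist x (T i) ≤ snnRad l (A x) u)) (fun i => σ i)
      ⟨N x, by simpa using snnRad_ge hl0 (hA0 x) u⟩
    exact ⟨i, by simpa using hi, fun j hj => hi' j (by simpa using hj)⟩
  choose I hI1 hI2 using hsel
  have hedge := snn_edge l hl T A hA0 hN hLip I hI1 hI2
  set K := 6 * Real.exp l + 9 / 2 * (1 + Real.log k) / l with hK
  have hedge' : ∀ e : Sym2 (Fin k), ∃ g : ℝ → ℝ, IntervalIntegrable g MeasureTheory.volume 0 1 ∧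
      ∫ u in (0:ℝ)..1, g u ≤ K * pairDist ps e ∧
      ∀ u, ∑ σ : Equiv.Perm (Fin k), pairDist (fun i => T (I (ps i) u σ)) e ≤
        (Nat.factorial k : ℝ) * g u := by
    intro e
    induction e using Sym2.ind with
    | _ a b => exact hedge (ps a) (ps b)
  choose g hg1 hg2 hg3 using hedge'
  have hgi : IntervalIntegrable (fun u => ∑ e ∈ E, g e u) MeasureTheory.volume 0 1 := by
    have h := IntervalIntegrable.sum E (fun e _ => hg1 e)
    have he : (fun u => ∑ e ∈ E, g e u) = ∑ e ∈ E, g e := by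
      funext u
      rw [Finset.sum_apply]
    rw [he]
    exact h
  set M := K * ∑ e ∈ E, pairDist ps e with hM
  have hint : ∫ u in (0:ℝ)..1, ∑ e ∈ E, g e u ≤ M := by
    rw [intervalIntegral.integral_finsetSum (fun e _ => hg1 e), hM, Finset.mul_sum]
    exact Finset.sum_le_sum (fun e _ => hg2 e)
  have hu : ∃ u, ∑ e ∈ E, g e u ≤ M := by
    by_contra hcon
    push Not at hcon
    have hpos := intervalIntegral.intervalIntegral_pos_of_pos
      (f := fun u => ∑ e ∈ E, g e u - M) (a := 0) (b := 1)
      (hgi.sub (by simp)) (fun u => by have := hcon u; linarith) (by norm_num)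
    rw [intervalIntegral.integral_sub hgi (by simp)] at hpos
    simp only [intervalIntegral.integral_const, sub_zero, one_smul] at hpos
    linarith
  obtain ⟨u, hu⟩ := hu
  have hfac : (0 : ℝ) < Nat.factorial k := by exact_mod_cast Nat.factorial_pos k
  have hσ : ∃ σ ∈ (Finset.univ : Finset (Equiv.Perm (Fin k))),
      ∑ e ∈ E, pairDist (fun i => T (I (ps i) u σ)) e ≤ M := by
    apply Finset.exists_le_of_sum_le Finset.univ_nonempty
    rw [Finset.sum_comm, Finset.sum_const, Finset.card_univ, Fintype.card_perm, Fintype.card_fin,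
      nsmul_eq_mul]
    calc _ ≤ ∑ e ∈ E, (Nat.factorial k : ℝ) * g e u := Finset.sum_le_sum (fun e _ => hg3 e u)
      _ = (Nat.factorial k : ℝ) * ∑ e ∈ E, g e u := by rw [Finset.mul_sum]
      _ ≤ _ := mul_le_mul_of_nonneg_left hu hfac.le
  obtain ⟨σ, _, hσ⟩ := hσ
  refine ⟨fun i => I (ps i) u σ, fun i => ?_, hσ⟩
  exact (hI1 (ps i) u σ).trans ((snnRad_le hl0 (hA0 _) u).trans
    (mul_le_mul_of_nonneg_left (hN (ps i) i) (Real.exp_pos l).le))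

lemma snn_pairDist_nonneg {V X : Type*} [MetricSpace X] (p : V → X) (e : Sym2 V) :
    0 ≤ pairDist p e := by
  induction e using Sym2.ind with
  | _ a b => exact dist_nonneg

lemma snn_const {k : ℕ} (hk : 3 ≤ k) : ∃ l : ℝ, 1 ≤ l ∧
    6 * Real.exp l + 9 / 2 * (1 + Real.log k) / l ≤
      60 * (Real.log k / Real.log (Real.log k)) := by
  set L := Real.log k with hL
  have hk' : (3 : ℝ) ≤ k := by exact_mod_cast hk
  have hL1 : 1 < L := by
    rw [hL, Real.lt_log_iff_exp_lt (by linarith)]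
    have := Real.exp_one_lt_d9
    linarith
  have hLL : 0 < Real.log L := Real.log_pos hL1
  refine ⟨1 + Real.log L / 2, by linarith, ?_⟩
  set s := Real.exp (Real.log L / 2) with hs
  have hs0 : 0 < s := Real.exp_pos _
  have hss : s * s = L := by
    rw [hs, ← Real.exp_add, add_halves, Real.exp_log (by linarith)]
  have hle : Real.log L ≤ 2 * s := by
    have := Real.add_one_le_exp (Real.log L / 2)
    linarith
  have h1 : s ≤ 2 * (L / Real.log L) := by
    rw [mul_div_assoc', le_div_iff₀ hLL]
    have := mul_le_mul_of_nonneg_left hle hs0.le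
    linarith
  have h2 : (1 + L) / (1 + Real.log L / 2) ≤ 4 * (L / Real.log L) := by
    rw [mul_div_assoc', div_le_div_iff₀ (by linarith) hLL]
    nlinarith
  have he : Real.exp 1 < 2.7182818286 := Real.exp_one_lt_d9
  have h3 : Real.exp (1 + Real.log L / 2) ≤ 2.7182818286 * s := by
    rw [Real.exp_add]
    exact mul_le_mul_of_nonneg_right he.le hs0.le
  rw [mul_div_assoc]
  linarith

/-- there is a universal constant `C > 0` such that for every SNN instance with
`k ≥ 3` queries there is an assignment taking values in the nearest-neighbor set `P̂` whose SNN
cost is at most `C · (log k / log log k)` times the optimal SNN cost over the full label set `P`;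
i.e. the pruning gap of INN is `O(log k / log log k)`. -/
theorem inn_pruning_gap_log :
    ∃ C : ℝ, 0 < C ∧
      ∀ (X : Type) [MetricSpace X] (k : ℕ), 3 ≤ k →
        ∀ (P : Finset X), P.Nonempty →
          ∀ (q : Fin k → X) (G : SimpleGraph (Fin k)) [Fintype G.edgeSet]
            (phat : Fin k → X), (∀ i, phat i ∈ P) →
            (∀ i, ∀ pt ∈ P, dist (q i) (phat i) ≤ dist (q i) pt) →
            ∃ p : Fin k → X, (∀ i, ∃ j, p i = phat j) ∧
              ∀ ps : Fin k → X, (∀ i, ps i ∈ P) →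
                ∑ i, dist (q i) (p i) + ∑ e ∈ G.edgeFinset, pairDist p e ≤
                  C * (Real.log k / Real.log (Real.log k)) *
                    (∑ i, dist (q i) (ps i) + ∑ e ∈ G.edgeFinset, pairDist ps e) := by
  refine ⟨60, by norm_num, ?_⟩
  intro X _ k hk P hP q G _ phat hphat hnn
  obtain ⟨l, hl, hconst⟩ := snn_const hk
  set α := Real.log k / Real.log (Real.log k) with hα
  obtain ⟨ps, hps, hopt⟩ := Finset.exists_min_image (Fintype.piFinset (fun _ : Fin k => P))
    (fun ps => ∑ i, dist (q i) (ps i) + ∑ e ∈ G.edgeFinset, pairDist ps e)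
    ⟨phat, by simpa using hphat⟩
  simp only [Fintype.mem_piFinset] at hps hopt
  obtain ⟨f, hf1, hf2⟩ := snn_round (by omega) l hl phat ps G.edgeFinset
  refine ⟨fun i => phat (f i), fun i => ⟨f i, rfl⟩, ?_⟩
  set K := 6 * Real.exp l + 9 / 2 * (1 + Real.log k) / l with hK
  have hR1 : 1 ≤ Real.exp l := Real.one_le_exp (by linarith)
  have hKR : 3 * Real.exp l ≤ K := by
    have : 0 ≤ 9 / 2 * (1 + Real.log k) / l := by
      have := Real.log_natCast_nonneg k
      positivity
    linarith
  have hq : ∑ i, dist (q i) (phat (f i)) ≤ K * ∑ i, dist (q i) (ps i) := by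
    rw [Finset.mul_sum]
    apply Finset.sum_le_sum
    intro i _
    have h1 := dist_triangle (q i) (ps i) (phat (f i))
    have h2 := dist_triangle_left (ps i) (phat i) (q i)
    have h3 := hnn i (ps i) (hps i)
    have h4 := hf1 i
    have h0 : 0 ≤ dist (q i) (ps i) := dist_nonneg
    have h5 : Real.exp l * dist (ps i) (phat i) ≤ Real.exp l * (2 * dist (q i) (ps i)) :=
      mul_le_mul_of_nonneg_left (by linarith) (by linarith)
    have h6 := mul_le_mul_of_nonneg_right hKR h0
    have h7 := mul_le_mul_of_nonneg_right hR1 h0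
    linarith
  intro ps' hps'
  have ho := hopt ps' hps'
  have hc0 : 0 ≤ ∑ i, dist (q i) (ps i) + ∑ e ∈ G.edgeFinset, pairDist ps e :=
    add_nonneg (Finset.sum_nonneg fun _ _ => dist_nonneg)
      (Finset.sum_nonneg fun _ _ => snn_pairDist_nonneg _ _)
  have hK0 : 0 ≤ K := by linarith
  calc _ ≤ K * (∑ i, dist (q i) (ps i) + ∑ e ∈ G.edgeFinset, pairDist ps e) := by
        rw [mul_add]
        exact add_le_add hq hf2
    _ ≤ (60 * α) * (∑ i, dist (q i) (ps i) + ∑ e ∈ G.edgeFinset, pairDist ps e) :=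
        mul_le_mul_of_nonneg_right hconst hc0
    _ ≤ _ := mul_le_mul_of_nonneg_left ho (hK0.trans hconst)
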